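/- Let C be an m×n Cauchon diagram and let K : v_0 ⇒ v and L : v ⇒ v_t be directed paths in the Cauchon graph G_C (the final vertex of K is the initial vertex of L). (1) If K or L contains only vertical edges, then w(K)w(L) = w(L)w(K). (2) If both K and L contain a horizontal edge, then w(K)w(L) = q^{-1}·w(L)w(K). -/

import Mathlib

universe u

/-- Quantum affine space data: a central unit `q` and units `t i j`
satisfying the quantum affine space commutation relations. -/
structure QMData (R : Type u) [Ring R] (m n : ℕ) where
  q : Rˣ
  t : Fin m → Fin n → Rˣ
  q_central : ∀ r : R, (q : R) * r = r * (q : R)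
  row_rel : ∀ (i : Fin m) ⦃j j' : Fin n⦄, j < j' →
    (t i j : R) * (t i j' : R) = (q : R) * ((t i j' : R) * (t i j : R))
  col_rel : ∀ ⦃i i' : Fin m⦄ (j : Fin n), i < i' →
    (t i j : R) * (t i' j : R) = (q : R) * ((t i' j : R) * (t i j : R))
  mixed_rel : ∀ ⦃i i' : Fin m⦄ ⦃j j' : Fin n⦄, i < i' → j ≠ j' →
    (t i j : R) * (t i' j' : R) = (t i' j' : R) * (t i j : R)

/-- `white i j = true` means the square `(i,j)` is white.  The Cauchon
condition: for every black square, either every square above it or every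
square to its left is also black. -/
def IsCauchon {m n : ℕ} (white : Fin m → Fin n → Bool) : Prop :=
  ∀ i j, white i j = false →
    (∀ i' : Fin m, i' < i → white i' j = false) ∨
    (∀ j' : Fin n, j' < j → white i j' = false)

/-- Vertices of the Cauchon graph: white squares, row vertices `r_i`,
column vertices `c_j`. -/
inductive CVertex (m n : ℕ) where
  | sq : Fin m → Fin n → CVertex m n
  | row : Fin m → CVertex m n
  | col : Fin n → CVertex m n
deriving DecidableEq

/-- Directed edges of the Cauchon graph. -/
inductive CEdge {m n : ℕ} (white : Fin m → Fin n → Bool) :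
    CVertex m n → CVertex m n → Prop where
  | fromRow (i : Fin m) (k : Fin n) :
      white i k = true → (∀ k' : Fin n, k < k' → white i k' = false) →
      CEdge white (.row i) (.sq i k)
  | toCol (i : Fin m) (j : Fin n) :
      white i j = true → (∀ i' : Fin m, i < i' → white i' j = false) →
      CEdge white (.sq i j) (.col j)
  | horiz (i : Fin m) (k j : Fin n) :
      j < k → white i k = true → white i j = true →
      (∀ j' : Fin n, j < j' → j' < k → white i j' = false) →
      CEdge white (.sq i k) (.sq i j)
  | vert (i i' : Fin m) (j : Fin n) :
      i < i' → white i j = true → white i' j = true →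
      (∀ l : Fin m, i < l → l < i' → white l j = false) →
      CEdge white (.sq i j) (.sq i' j)

/-- The weight of an edge of the Cauchon graph (1 on non-edges). -/
def wt {R : Type u} {m n : ℕ} [Ring R] (D : QMData R m n) :
    CVertex m n → CVertex m n → R
  | .row i, .sq i' k => if i = i' then (D.t i' k : R) else 1
  | .sq i k, .sq i' j =>
      if i = i' ∧ j < k then (↑((D.t i k)⁻¹) * ↑(D.t i j) : R) else 1
  | _, _ => 1

/-- A pair of vertices spans a horizontal edge (edges from `r_i` are
horizontal; edges between squares are horizontal iff the rows agree). -/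
def Horiz {m n : ℕ} : CVertex m n → CVertex m n → Prop
  | .row _, _ => True
  | .sq i _, .sq i' _ => i = i'
  | _, _ => False

/-- `l` is (the list of vertices of) a directed path from `u` to `v`. -/
def IsPathFrom {m n : ℕ} (white : Fin m → Fin n → Bool) (u v : CVertex m n)
    (l : List (CVertex m n)) : Prop :=
  l.Chain' (CEdge white) ∧ l.head? = some u ∧ l.getLast? = some v

/-- The list of (endpoint pairs of the) edges of a path. -/
def steps {m n : ℕ} (l : List (CVertex m n)) : List (CVertex m n × CVertex m n) :=
  l.zip l.tail

/-- The weight of a path: the ordered product of its edge weights. -/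
def pathWeight {R : Type u} {m n : ℕ} [Ring R] (D : QMData R m n)
    (l : List (CVertex m n)) : R :=
  ((steps l).map fun p => wt D p.1 p.2).prod

/-- The number of inversions (length) of a permutation of `Fin k`. -/
def invCount {k : ℕ} (σ : Equiv.Perm (Fin k)) : ℕ :=
  ((Finset.univ : Finset (Fin k × Fin k)).filter fun p => p.1 < p.2 ∧ σ p.2 < σ p.1).card

/-- The quantum determinant of a `k × k` matrix over a (noncommutative) ring. -/
def qdet {R : Type u} [Ring R] {k : ℕ} (q : Rˣ) (N : Matrix (Fin k) (Fin k) R) : R :=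
  ∑ σ : Equiv.Perm (Fin k),
    (-(q : R)) ^ invCount σ * ((List.finRange k).map fun i => N i (σ i)).prod

/-- The path matrix: entry `(i,j)` is the sum of the weights of all directed
paths from `r_i` to `c_j` (zero when there are none). -/
noncomputable def pathMatrix {R : Type u} {m n : ℕ} [Ring R] (D : QMData R m n)
    (white : Fin m → Fin n → Bool) : Matrix (Fin m) (Fin n) R :=
  Matrix.of fun i j =>
    ∑ᶠ p : {l : List (CVertex m n) // IsPathFrom white (.row i) (.col j) l},
      pathWeight D p.1

/-- An `(R_I, C_J)`-path system: paths `P ℓ : r_{i_ℓ} ⇒ c_{j_{σ ℓ}}`. -/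
structure PathSys {m n : ℕ} (white : Fin m → Fin n → Bool) {k : ℕ}
    (ι : Fin k → Fin m) (κ : Fin k → Fin n) where
  σ : Equiv.Perm (Fin k)
  P : Fin k → List (CVertex m n)
  isPath : ∀ l : Fin k, IsPathFrom white (.row (ι l)) (.col (κ (σ l))) (P l)

/-- A path system is vertex-disjoint if no two of its paths share a vertex. -/
def PathSys.VertexDisjoint {m n : ℕ} {white : Fin m → Fin n → Bool} {k : ℕ}
    {ι : Fin k → Fin m} {κ : Fin k → Fin n} (S : PathSys white ι κ) : Prop :=
  ∀ a b : Fin k, a ≠ b → ∀ x : CVertex m n, x ∈ S.P a → x ∈ S.P b → False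

/-- The weight of a path system: the ordered product `w(P₁)⋯w(P_k)`. -/
def PathSys.weight {R : Type u} {m n : ℕ} [Ring R] (D : QMData R m n)
    {white : Fin m → Fin n → Bool} {k : ℕ} {ι : Fin k → Fin m} {κ : Fin k → Fin n}
    (S : PathSys white ι κ) : R :=
  ((List.finRange k).map fun l => pathWeight D (S.P l)).prod

/-- The `q`-sign of a path system: `(-q) ^ ℓ(σ_P)`. -/
def PathSys.sgnq {R : Type u} {m n : ℕ} [Ring R] (D : QMData R m n)
    {white : Fin m → Fin n → Bool} {k : ℕ} {ι : Fin k → Fin m} {κ : Fin k → Fin n}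
    (S : PathSys white ι κ) : R :=
  (-(D.q : R)) ^ invCount S.σ

/-- The path with vertex list `l` contains a horizontal edge. -/
def HasHoriz {m n : ℕ} (l : List (CVertex m n)) : Prop :=
  ∃ p ∈ steps l, Horiz p.1 p.2

theorem not_hasHoriz_singleton {m n : ℕ} (u : CVertex m n) : ¬ HasHoriz [u] := by
  simp [HasHoriz, steps]

theorem hasHoriz_cons_cons {m n : ℕ} (u u' : CVertex m n) (l : List (CVertex m n)) :
    HasHoriz (u :: u' :: l) ↔ Horiz u u' ∨ HasHoriz (u' :: l) := by
  simp [HasHoriz, steps]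

theorem CEdge.not_from_col {m n : ℕ} {white : Fin m → Fin n → Bool} {j : Fin n}
    {u : CVertex m n} : ¬ CEdge white (.col j) u := by
  rintro ⟨⟩

theorem CEdge.not_to_row {m n : ℕ} {white : Fin m → Fin n → Bool} {i : Fin m}
    {u : CVertex m n} : ¬ CEdge white u (.row i) := by
  rintro ⟨⟩

section Weights

variable {R : Type u} [Ring R] {m n : ℕ} (D : QMData R m n)

theorem pathWeight_singleton (u : CVertex m n) : pathWeight D [u] = 1 := by
  simp [pathWeight, steps]

theorem pathWeight_cons_cons (u u' : CVertex m n) (l : List (CVertex m n)) :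
    pathWeight D (u :: u' :: l) = wt D u u' * pathWeight D (u' :: l) := by
  simp [pathWeight, steps]

theorem wt_of_not_horiz {u u' : CVertex m n} (h : ¬ Horiz u u') : wt D u u' = 1 := by
  cases u <;> cases u' <;> simp_all [Horiz, wt]

theorem pathWeight_of_not_hasHoriz {l : List (CVertex m n)} (h : ¬ HasHoriz l) :
    pathWeight D l = 1 := by
  refine List.prod_eq_one fun x hx => ?_
  obtain ⟨p, hp, rfl⟩ := List.mem_map.1 hx
  exact wt_of_not_horiz D fun hh => h ⟨p, hp, hh⟩

theorem QMData.commute_q (r : R) : Commute (D.q : R) r :=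
  D.q_central r

theorem QMData.commute_q_inv (r : R) : Commute (↑D.q⁻¹ : R) r :=
  (D.commute_q r).units_inv_left

theorem QMData.commute_of_ne {i s : Fin m} {j l : Fin n} (his : i < s) (hjl : j ≠ l) :
    Commute (D.t i j : R) (D.t s l : R) :=
  D.mixed_rel his hjl

theorem QMData.semiconj_row (i : Fin m) {j l : Fin n} (h : l < j) :
    SemiconjBy (D.t i j : R) (D.t i l : R) (↑(D.q⁻¹ * D.t i l) : R) := by
  have := D.row_rel i h
  rw [SemiconjBy, Units.val_mul, mul_assoc, this, Units.inv_mul_cancel_left]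

theorem QMData.semiconj_col {i s : Fin m} (j : Fin n) (h : i < s) :
    SemiconjBy (D.t i j : R) (D.t s j : R) (↑(D.q * D.t s j) : R) := by
  rw [SemiconjBy, Units.val_mul, mul_assoc]
  exact D.col_rel j h

/-- A generator commutes with the weight of a horizontal edge lying weakly below it and starting
strictly to its left. -/
theorem QMData.commute_horiz {i s : Fin m} {j l p : Fin n} (his : i ≤ s) (hlj : l < j)
    (hpl : p < l) :
    Commute (D.t i j : R) (↑(D.t s l)⁻¹ * ↑(D.t s p) : R) := by
  rcases his.lt_or_eq with h | rfl
  · exact (D.commute_of_ne h hlj.ne').units_inv_right.mul_right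
      (D.commute_of_ne h (hpl.trans hlj).ne')
  · have key := (D.semiconj_row i hlj).units_inv_right.mul_right
      (D.semiconj_row i (hpl.trans hlj))
    rwa [mul_inv_rev, inv_inv, Units.val_mul, Units.val_mul, mul_assoc,
      Units.mul_inv_cancel_left] at key

/-- A generator `q⁻¹`-commutes with the weight of a horizontal edge lying weakly below it and
starting in its column. -/
theorem QMData.semiconj_horiz {i s : Fin m} {l p : Fin n} (his : i ≤ s) (hpl : p < l) :
    SemiconjBy (D.t i l : R) (↑(D.t s l)⁻¹ * ↑(D.t s p) : R)
      (↑D.q⁻¹ * (↑(D.t s l)⁻¹ * ↑(D.t s p)) : R) := by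
  rcases his.lt_or_eq with h | rfl
  · have key := SemiconjBy.mul_right (D.semiconj_col l h).units_inv_right
      (D.commute_of_ne h hpl.ne')
    rwa [mul_inv_rev, Units.val_mul, ← (D.commute_q_inv _).eq, mul_assoc] at key
  · have key := SemiconjBy.mul_right (Commute.refl (D.t i l : R)).units_inv_right
      (D.semiconj_row i hpl)
    rwa [Units.val_mul, ← mul_assoc, ← (D.commute_q_inv _).eq, mul_assoc] at key

variable {white : Fin m → Fin n → Bool}

/-- A generator commutes with the weight of every path that starts weakly below it and strictly
to its left. -/
theorem QMData.commute_pathWeight {i : Fin m} {j : Fin n} (L : List (CVertex m n)) :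
    ∀ {s : Fin m} {l : Fin n}, i ≤ s → l < j → (CVertex.sq s l :: L).IsChain (CEdge white) →
      Commute (D.t i j : R) (pathWeight D (.sq s l :: L)) := by
  induction L with
  | nil =>
    intro s l _ _ _
    rw [pathWeight_singleton]
    exact Commute.one_right _
  | cons u L ih =>
    intro s l his hlj hL
    rw [List.isChain_cons_cons] at hL
    obtain ⟨he, hL⟩ := hL
    rw [pathWeight_cons_cons]
    cases he with
    | toCol _ _ _ _ =>
      cases L with
      | nil => simp [wt, pathWeight_singleton]
      | cons => exact absurd (List.isChain_cons_cons.1 hL).1 CEdge.not_from_col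
    | horiz _ _ p hpl _ _ _ =>
      have hw : wt D (.sq s l) (.sq s p) = ↑(D.t s l)⁻¹ * ↑(D.t s p) := by simp [wt, hpl]
      rw [hw]
      exact (D.commute_horiz his hlj hpl).mul_right (ih his (hpl.trans hlj) hL)
    | vert _ s' _ hs _ _ _ =>
      rw [wt_of_not_horiz D (u := .sq s l) (u' := .sq s' l) hs.ne, one_mul]
      exact ih (his.trans hs.le) hlj hL

/-- A generator `q⁻¹`-commutes with the weight of every non-vertical path that starts weakly
below it in its column. -/
theorem QMData.semiconj_pathWeight {i : Fin m} {l : Fin n} (L : List (CVertex m n)) :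
    ∀ {s : Fin m}, i ≤ s → (CVertex.sq s l :: L).IsChain (CEdge white) →
      HasHoriz (.sq s l :: L) →
      SemiconjBy (D.t i l : R) (pathWeight D (.sq s l :: L))
        (↑D.q⁻¹ * pathWeight D (.sq s l :: L)) := by
  induction L with
  | nil => exact fun _ _ h => absurd h (not_hasHoriz_singleton _)
  | cons u L ih =>
    intro s his hL hh
    rw [List.isChain_cons_cons] at hL
    obtain ⟨he, hL⟩ := hL
    rw [pathWeight_cons_cons]
    rw [hasHoriz_cons_cons] at hh
    cases he with
    | toCol _ _ _ _ =>
      cases L with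
      | nil => exact absurd (hh.resolve_left id) (not_hasHoriz_singleton _)
      | cons => exact absurd (List.isChain_cons_cons.1 hL).1 CEdge.not_from_col
    | horiz _ _ p hpl _ _ _ =>
      have hw : wt D (.sq s l) (.sq s p) = ↑(D.t s l)⁻¹ * ↑(D.t s p) := by simp [wt, hpl]
      rw [hw, ← mul_assoc (↑D.q⁻¹ : R)]
      exact (D.semiconj_horiz his hpl).mul_right (D.commute_pathWeight L his hpl hL)
    | vert _ s' _ hs _ _ _ =>
      rw [wt_of_not_horiz D (u := .sq s l) (u' := .sq s' l) hs.ne, one_mul]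
      exact ih (his.trans hs.le) hL (hh.resolve_left hs.ne)

/-- A path between squares goes weakly down, and goes strictly to the left exactly when it has a
horizontal edge. -/
theorem path_monotone {s : Fin m} {l : Fin n} (K : List (CVertex m n)) :
    ∀ {i : Fin m} {j : Fin n}, (CVertex.sq i j :: K).IsChain (CEdge white) →
      (CVertex.sq i j :: K).getLast? = some (.sq s l) →
      i ≤ s ∧ (HasHoriz (.sq i j :: K) → l < j) ∧ (¬ HasHoriz (.sq i j :: K) → l = j) := by
  induction K with
  | nil =>
    intro i j _ hlast
    simp only [List.getLast?_singleton, Option.some.injEq, CVertex.sq.injEq] at hlast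
    obtain ⟨rfl, rfl⟩ := hlast
    exact ⟨le_rfl, fun h => absurd h (not_hasHoriz_singleton _), fun _ => rfl⟩
  | cons u K ih =>
    intro i j hK hlast
    rw [List.isChain_cons_cons] at hK
    obtain ⟨he, hK⟩ := hK
    rw [List.getLast?_cons_cons] at hlast
    rw [hasHoriz_cons_cons]
    cases he with
    | toCol _ _ _ _ =>
      cases K with
      | nil => simp at hlast
      | cons => exact absurd (List.isChain_cons_cons.1 hK).1 CEdge.not_from_col
    | horiz _ _ p hpj _ _ _ =>
      obtain ⟨his, hlt, heq⟩ := ih hK hlast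
      refine ⟨his, fun _ => ?_, fun h => absurd (Or.inl rfl) h⟩
      by_cases hh : HasHoriz (.sq i p :: K)
      · exact (hlt hh).trans hpj
      · exact (heq hh).trans_lt hpj
    | vert _ i' _ hi _ _ _ =>
      obtain ⟨his, hlt, heq⟩ := ih hK hlast
      exact ⟨hi.le.trans his, fun h => hlt (h.resolve_left hi.ne), fun h => heq (mt Or.inr h)⟩

/-- Suppose `e` commutes with `x` when the path `K` ends strictly to the left of its start, and
`q⁻¹`-commutes with `x` when it ends in the same column. If `w(K)` also `q⁻¹`-commutes with `x`
whenever `K` has a horizontal edge, then so does `e * w(K)`, unconditionally. -/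
theorem semiconj_mul_pathWeight {i s : Fin m} {j l : Fin n} {K : List (CVertex m n)} {e x : R}
    (hK : (CVertex.sq i j :: K).IsChain (CEdge white))
    (hlast : (CVertex.sq i j :: K).getLast? = some (.sq s l))
    (hlt : l < j → Commute e x) (heq : l = j → SemiconjBy e x (↑D.q⁻¹ * x))
    (ih : HasHoriz (.sq i j :: K) →
      SemiconjBy (pathWeight D (.sq i j :: K)) x (↑D.q⁻¹ * x)) :
    SemiconjBy (e * pathWeight D (.sq i j :: K)) x (↑D.q⁻¹ * x) := by
  obtain ⟨-, h₁, h₂⟩ := path_monotone K hK hlast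
  by_cases hh : HasHoriz (.sq i j :: K)
  · exact SemiconjBy.mul_left ((D.commute_q_inv e).symm.mul_right (hlt (h₁ hh))) (ih hh)
  · rw [pathWeight_of_not_hasHoriz D hh, mul_one]
    exact heq (h₂ hh)

/-- The weights of consecutive paths through a square `q⁻¹`-commute if both paths have a horizontal
edge. -/
theorem semiconj_pathWeight_pathWeight {s : Fin m} {l : Fin n} {L : List (CVertex m n)}
    (hL : (CVertex.sq s l :: L).IsChain (CEdge white)) (hhL : HasHoriz (.sq s l :: L))
    (K : List (CVertex m n)) :
    ∀ {u : CVertex m n}, (u :: K).IsChain (CEdge white) →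
      (u :: K).getLast? = some (.sq s l) → HasHoriz (u :: K) →
      SemiconjBy (pathWeight D (u :: K)) (pathWeight D (.sq s l :: L))
        (↑D.q⁻¹ * pathWeight D (.sq s l :: L)) := by
  induction K with
  | nil => exact fun _ _ h => absurd h (not_hasHoriz_singleton _)
  | cons u' K ih =>
    intro u hK hlast hh
    rw [List.isChain_cons_cons] at hK
    obtain ⟨he, hK⟩ := hK
    rw [List.getLast?_cons_cons] at hlast
    rw [hasHoriz_cons_cons] at hh
    rw [pathWeight_cons_cons]
    cases he with
    | toCol _ _ _ _ =>
      cases K with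
      | nil => simp at hlast
      | cons => exact absurd (List.isChain_cons_cons.1 hK).1 CEdge.not_from_col
    | fromRow i k _ _ =>
      have hw : wt D (.row i) (.sq i k) = D.t i k := by simp [wt]
      have his := (path_monotone K hK hlast).1
      rw [hw]
      refine semiconj_mul_pathWeight D hK hlast (fun h => D.commute_pathWeight L his h hL) ?_
        (ih hK hlast)
      rintro rfl
      exact D.semiconj_pathWeight L his hL hhL
    | horiz i k j hjk _ _ _ =>
      have hw : wt D (.sq i k) (.sq i j) = ↑(D.t i k)⁻¹ * ↑(D.t i j) := by simp [wt, hjk]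
      have his := (path_monotone K hK hlast).1
      have hk : l ≤ j → Commute (↑(D.t i k)⁻¹ : R) (pathWeight D (.sq s l :: L)) := fun h =>
        (D.commute_pathWeight L his (h.trans_lt hjk) hL).units_inv_left
      rw [hw]
      refine semiconj_mul_pathWeight D hK hlast
        (fun h => (hk h.le).mul_left (D.commute_pathWeight L his h hL)) ?_ (ih hK hlast)
      rintro rfl
      exact SemiconjBy.mul_left ((D.commute_q_inv _).symm.mul_right (hk le_rfl))
        (D.semiconj_pathWeight L his hL hhL)
    | vert i i' j hi _ _ _ =>
      rw [wt_of_not_horiz D (u := .sq i j) (u' := .sq i' j) hi.ne, one_mul]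
      exact ih hK hlast (hh.resolve_left hi.ne)

end Weights

theorem not_hasHoriz_of_getLast_row {m n : ℕ} {white : Fin m → Fin n → Bool} {i : Fin m}
    (K : List (CVertex m n)) (hK : K.IsChain (CEdge white))
    (hlast : K.getLast? = some (.row i)) : ¬ HasHoriz K := by
  rcases List.eq_nil_or_concat' K with rfl | ⟨K, u, rfl⟩
  · simp at hlast
  obtain rfl : u = .row i := by simpa using hlast
  rcases List.eq_nil_or_concat' K with rfl | ⟨K, u, rfl⟩
  · exact not_hasHoriz_singleton _
  · rw [List.append_assoc, List.isChain_append] at hK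
    exact absurd (List.isChain_cons_cons.1 hK.2.1).1 CEdge.not_to_row

theorem not_hasHoriz_cons_col {m n : ℕ} {white : Fin m → Fin n → Bool} {j : Fin n}
    (L : List (CVertex m n)) (hL : (CVertex.col j :: L).IsChain (CEdge white)) :
    ¬ HasHoriz (.col j :: L) := by
  cases L with
  | nil => exact not_hasHoriz_singleton _
  | cons => exact absurd (List.isChain_cons_cons.1 hL).1 CEdge.not_from_col


/-- for paths `K : v₀ ⇒ v` and `L : v ⇒ v_t`:
(1) if `K` or `L` has only vertical edges, their weights commute;
(2) if both contain a horizontal edge, `w(K)w(L) = q⁻¹·w(L)w(K)`. -/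
theorem consecutive_paths_comm {R : Type u} [Ring R] {m n : ℕ} (D : QMData R m n)
    (white : Fin m → Fin n → Bool) (hC : IsCauchon white)
    (v0 v vt : CVertex m n) (K L : List (CVertex m n))
    (hK : IsPathFrom white v0 v K) (hL : IsPathFrom white v vt L) :
    (((∀ p ∈ steps K, ¬ Horiz p.1 p.2) ∨ (∀ p ∈ steps L, ¬ Horiz p.1 p.2)) →
      pathWeight D K * pathWeight D L = pathWeight D L * pathWeight D K) ∧
    ((∃ p ∈ steps K, Horiz p.1 p.2) → (∃ p ∈ steps L, Horiz p.1 p.2) →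
      pathWeight D K * pathWeight D L = ↑(D.q⁻¹) * (pathWeight D L * pathWeight D K)) := by
  obtain ⟨hKc, -, hKv⟩ := hK
  obtain ⟨hLc, hLv, -⟩ := hL
  refine ⟨?_, fun hhK hhL => ?_⟩
  · rintro (h | h)
    · have hw := pathWeight_of_not_hasHoriz D (l := K) fun ⟨p, hp, hh⟩ => h p hp hh
      rw [hw, one_mul, mul_one]
    · have hw := pathWeight_of_not_hasHoriz D (l := L) fun ⟨p, hp, hh⟩ => h p hp hh
      rw [hw, one_mul, mul_one]
  · obtain ⟨L, rfl⟩ := List.head?_eq_some_iff.1 hLv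
    cases v with
    | row i => exact absurd hhK (not_hasHoriz_of_getLast_row K hKc hKv)
    | col j => exact absurd hhL (not_hasHoriz_cons_col L hLc)
    | sq s l =>
      cases K with
      | nil => simp at hKv
      | cons u K =>
        rw [← mul_assoc]
        exact semiconj_pathWeight_pathWeight D hLc hhL K hKc hKv hhK
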